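/- arXiv:2503.00694 — 14 statements merged into one kernel-verified Lean document; each statement's English description precedes it below -/
import Mathlib

section
/- Let a, t, x, s be real numbers with a ≥ 1, t ≥ a, 0 ≤ x ≤ 1, and a/t ≤ s ≤ 1. Then (1+t)^x ≥ (1 + a/s)^(x−1) + (1 + s/a)^(x−1)·t^x. -/
open Real

/-- Concavity of `y ↦ y ^ x`, applied to `1 + t` written as the average of `1 + u` and
`(1 + u⁻¹) * t` with weights `(1 + u)⁻¹` and `(1 + u⁻¹)⁻¹`. -/
theorem rpow_sub_one_add_mul_rpow_le {t u x : ℝ} (ht : 0 ≤ t) (hu : 0 < u)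
    (hx0 : 0 ≤ x) (hx1 : x ≤ 1) :
    (1 + u) ^ (x - 1) + (1 + u⁻¹) ^ (x - 1) * t ^ x ≤ (1 + t) ^ x := by
  have hp : 0 < 1 + u := by positivity
  have hq : 0 < 1 + u⁻¹ := by positivity
  have h := (concaveOn_rpow hx0 hx1).2 (x := 1 + u) (y := (1 + u⁻¹) * t)
    (Set.mem_Ici.2 hp.le) (Set.mem_Ici.2 (by positivity))
    (inv_nonneg.2 hp.le) (inv_nonneg.2 hq.le) (by field_simp; ring)
  simp only [smul_eq_mul] at h
  rw [inv_mul_cancel₀ hp.ne', inv_mul_cancel_left₀ hq.ne', mul_rpow hq.le ht] at h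
  rw [rpow_sub_one hp.ne', rpow_sub_one hq.ne']
  exact (Eq.le (by ring)).trans h

/-- Lemma 2.1, first inequality: parameterized lower binomial estimate for `0 ≤ x ≤ 1`. -/
theorem param_binomial_lower_first (a t x s : ℝ) (ha : 1 ≤ a) (hta : a ≤ t)
    (hx0 : 0 ≤ x) (hx1 : x ≤ 1) (hs0 : a / t ≤ s) (hs1 : s ≤ 1) :
    (1 + t) ^ x ≥ (1 + a / s) ^ (x - 1) + (1 + s / a) ^ (x - 1) * t ^ x := by
  have ha0 : 0 < a := by linarith
  have ht0 : 0 < t := by linarith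
  have hs : 0 < s := (div_pos ha0 ht0).trans_le hs0
  rw [← inv_div a s]
  exact rpow_sub_one_add_mul_rpow_le ht0.le (div_pos ha0 hs) hx0 hx1
end

section
/- Let a, t, x, s be real numbers with a ≥ 1, t ≥ a, 0 ≤ x ≤ 1, and a/t ≤ s ≤ 1. Then (1 + a/s)^(x−1) + (1 + s/a)^(x−1)·t^x ≥ (1 + a)^(x−1) + (1 + 1/a)^(x−1)·t^x. -/
open Real

theorem one_add_one_div_rpow_sub_one {w : ℝ} (hw : 0 < w) (x : ℝ) :
    (1 + 1 / w) ^ (x - 1) = w / w ^ x * (1 + w) ^ (x - 1) := by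
  have h : 1 + 1 / w = (1 + w) / w := by field_simp; ring
  rw [h, div_rpow (by positivity) hw.le, rpow_sub_one hw.ne']
  have := (rpow_pos_of_pos hw x).ne'
  field_simp

/-- Concavity of `y ↦ y ^ x` at the points `1` and `v` with weights proportional to `1` and `a`. -/
theorem one_add_mul_rpow_le {a v x : ℝ} (ha : 0 < a) (hv : 0 ≤ v) (hx0 : 0 ≤ x) (hx1 : x ≤ 1) :
    (1 + a) ^ (x - 1) * (1 + a * v ^ x) ≤ (1 + a * v) ^ x := by
  have ha' : 0 < 1 + a := by positivity
  have h : 1 / (1 + a) * 1 ^ x + a / (1 + a) * v ^ x ≤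
      (1 / (1 + a) * 1 + a / (1 + a) * v) ^ x :=
    (concaveOn_rpow hx0 hx1).2 (Set.mem_Ici.2 zero_le_one) (Set.mem_Ici.2 hv)
      (by positivity) (by positivity) (by field_simp)
  have e : 1 / (1 + a) * 1 + a / (1 + a) * v = (1 + a * v) / (1 + a) := by field_simp
  rw [e, one_rpow, div_rpow (by positivity) ha'.le, le_div_iff₀ (rpow_pos_of_pos ha' x)] at h
  rw [rpow_sub_one ha'.ne']
  calc _ = (1 / (1 + a) * 1 + a / (1 + a) * v ^ x) * (1 + a) ^ x := by field_simp
    _ ≤ _ := h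

/-- Lemma 2.1, second inequality: the parameterized lower bound with `s ≤ 1`
dominates the bound at `s = 1`. -/
theorem param_binomial_lower_second (a t x s : ℝ) (ha : 1 ≤ a) (hta : a ≤ t)
    (hx0 : 0 ≤ x) (hx1 : x ≤ 1) (hs0 : a / t ≤ s) (hs1 : s ≤ 1) :
    (1 + a / s) ^ (x - 1) + (1 + s / a) ^ (x - 1) * t ^ x ≥
      (1 + a) ^ (x - 1) + (1 + 1 / a) ^ (x - 1) * t ^ x := by
  have ha0 : 0 < a := by linarith
  have ht0 : 0 < t := by linarith
  have hs : 0 < s := (div_pos ha0 ht0).trans_le hs0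
  have hw : 0 < a / s := div_pos ha0 hs
  have hwt : (a / s) ^ x ≤ t ^ x :=
    rpow_le_rpow hw.le ((div_le_comm₀ ht0 hs).1 hs0) hx0
  have hmono : (1 + 1 / a) ^ (x - 1) ≤ (1 + s / a) ^ (x - 1) :=
    rpow_le_rpow_of_nonpos (by positivity) (by gcongr) (by linarith)
  have hleft : (1 + a / s) ^ (x - 1) + (1 + s / a) ^ (x - 1) * (a / s) ^ x = (1 + a / s) ^ x := by
    have hsa : s / a = 1 / (a / s) := (one_div_div a s).symm
    have h1w : 0 < 1 + a / s := by positivity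
    have hwx := (rpow_pos_of_pos hw x).ne'
    rw [hsa, one_add_one_div_rpow_sub_one hw, rpow_sub_one h1w.ne', mul_right_comm,
      div_mul_cancel₀ _ hwx, ← one_add_mul, mul_div_cancel₀ _ h1w.ne']
  have hright : (1 + a) ^ (x - 1) + (1 + 1 / a) ^ (x - 1) * (a / s) ^ x ≤ (1 + a / s) ^ x := by
    have h := one_add_mul_rpow_le ha0 (one_div_pos.2 hs).le hx0 hx1
    rw [mul_one_div] at h
    convert h using 1
    rw [one_add_one_div_rpow_sub_one ha0, div_rpow ha0.le hs.le, div_rpow zero_le_one hs.le,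
      one_rpow]
    have := (rpow_pos_of_pos ha0 x).ne'
    field_simp
  linarith [mul_nonneg (sub_nonneg.2 hmono) (sub_nonneg.2 hwt)]
end

section
/- Let a, t, x be real numbers with a ≥ 1, t ≥ a, and 0 ≤ x ≤ 1. Then (1 + a)^(x−1) + (1 + 1/a)^(x−1)·t^x ≥ 1 + (((1+a)^x − 1)/a^x)·t^x. -/
open Real

/-- Lemma 2.1, third inequality. -/
theorem binomial_lower_third (a t x : ℝ) (ha : 1 ≤ a) (hta : a ≤ t)
    (hx0 : 0 ≤ x) (hx1 : x ≤ 1) :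
    (1 + a) ^ (x - 1) + (1 + 1 / a) ^ (x - 1) * t ^ x ≥
      1 + (((1 + a) ^ x - 1) / a ^ x) * t ^ x := by
  have ha0 : 0 < a := by linarith
  have h1a : 0 < 1 + a := by linarith
  have hA : 0 < a ^ x := rpow_pos_of_pos ha0 x
  have hAT : a ^ x ≤ t ^ x := rpow_le_rpow ha0.le hta hx0
  have hP : (1 + a) ^ x ≤ 1 + a := by
    simpa using rpow_le_rpow_of_exponent_le (by linarith : 1 ≤ 1 + a) hx1
  have hquot : 1 + 1 / a = (1 + a) / a := by field_simp; ring
  rw [hquot, rpow_sub_one h1a.ne', rpow_sub_one (by positivity), div_rpow h1a.le ha0.le]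
  have key : 0 ≤ (t ^ x / a ^ x - 1) * (1 - (1 + a) ^ x / (1 + a)) :=
    mul_nonneg (sub_nonneg.2 ((one_le_div hA).2 hAT)) (sub_nonneg.2 ((div_le_one h1a).2 hP))
  rw [ge_iff_le, ← sub_nonneg]
  convert key using 1
  field_simp
  ring
end

section
/- Let a, t, x be real numbers with a ≥ 1, t ≥ a, and 0 ≤ x ≤ 1. Then 1 + (((1+a)^x − 1)/a^x)·t^x ≥ 1 + (2^x − 1)·t^x; equivalently, ((1+a)^x − 1)/a^x ≥ 2^x − 1. -/
open Real

/-- A concave function takes a larger sum at two interior points than at the endpoints with the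
same sum. -/
lemma ConcaveOn.add_le_add_of_add_eq {s : Set ℝ} {f : ℝ → ℝ} (hf : ConcaveOn ℝ s f)
    {u v p q : ℝ} (hu : u ∈ s) (hv : v ∈ s) (hup : u ≤ p) (hpv : p ≤ v)
    (hsum : p + q = u + v) : f u + f v ≤ f p + f q := by
  rcases (hup.trans hpv).eq_or_lt with rfl | huv
  · obtain rfl : p = u := le_antisymm hpv hup
    obtain rfl : q = p := by linarith
    exact le_rfl
  have hpos : 0 < v - u := sub_pos.2 huv
  set l := (p - u) / (v - u) with hl
  have hl0 : 0 ≤ l := div_nonneg (sub_nonneg.2 hup) hpos.le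
  have hl1 : 0 ≤ 1 - l := sub_nonneg.2 ((div_le_one hpos).2 (by linarith))
  have hlp : l * (v - u) = p - u := div_mul_cancel₀ _ hpos.ne'
  have h₁ := hf.2 hu hv hl1 hl0 (by ring)
  have h₂ := hf.2 hu hv hl0 hl1 (by ring)
  simp only [smul_eq_mul] at h₁ h₂
  rw [show (1 - l) * u + l * v = p by linarith] at h₁
  rw [show l * u + (1 - l) * v = q by linarith] at h₂
  linarith

/-- Lemma 2.1, last inequality, recovering the classical bound
`(1+t)^x ≥ 1 + (2^x − 1) t^x`. -/
theorem binomial_lower_fourth (a t x : ℝ) (ha : 1 ≤ a) (hta : a ≤ t)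
    (hx0 : 0 ≤ x) (hx1 : x ≤ 1) :
    1 + (((1 + a) ^ x - 1) / a ^ x) * t ^ x ≥ 1 + ((2 : ℝ) ^ x - 1) * t ^ x ∧
      ((1 + a) ^ x - 1) / a ^ x ≥ (2 : ℝ) ^ x - 1 := by
  have ha0 : 0 < a := by linarith
  have key : ((1 + a) ^ x - 1) / a ^ x ≥ (2 : ℝ) ^ x - 1 := by
    have h := (Real.concaveOn_rpow hx0 hx1).add_le_add_of_add_eq
      (u := 1) (v := 2 * a) (p := a) (q := 1 + a)
      (Set.mem_Ici.2 zero_le_one) (Set.mem_Ici.2 (by linarith)) ha (by linarith) (by ring)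
    rw [Real.one_rpow, Real.mul_rpow zero_le_two ha0.le] at h
    rw [ge_iff_le, le_div_iff₀ (Real.rpow_pos_of_pos ha0 x)]
    linarith
  have ht : 0 ≤ t ^ x := Real.rpow_nonneg (ha0.le.trans hta) x
  exact ⟨add_le_add_right (mul_le_mul_of_nonneg_right key ht) 1, key⟩
end

section
/- Let N ≥ 2 be an integer, let p_1 ≥ p_2 ≥ ⋯ ≥ p_N > 0 be real numbers, let 0 ≤ x ≤ 1, and set r = max over h = 1, …, N−1 of h·p_{h+1}/(p_1 + ⋯ + p_h). Then for every real s with r ≤ s ≤ 1: (∑_{i=1}^{N} p_i)^x ≥ ∑_{k=1}^{N−1} (1 + (k−1)/s)^(x−1) · ∏_{j=1}^{N−k} (1 + s/(N−j))^(x−1) · p_k^x + (1 + (N−1)/s)^(x−1) · p_N^x. -/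
open Real Finset

/-- Two-term Hölder inequality for `0 ≤ x ≤ 1`, with conjugate weights `u⁻¹ + v⁻¹ = 1`. -/
theorem rpow_sub_one_mul_add_le_add_rpow {u v a b x : ℝ} (hu : 0 < u) (hv : 0 < v)
    (huv : u⁻¹ + v⁻¹ = 1) (ha : 0 ≤ a) (hb : 0 ≤ b) (hx0 : 0 ≤ x) (hx1 : x ≤ 1) :
    u ^ (x - 1) * a ^ x + v ^ (x - 1) * b ^ x ≤ (a + b) ^ x := by
  have h := (Real.concaveOn_rpow hx0 hx1).2 (x := u * a) (y := v * b)
    (Set.mem_Ici.2 (by positivity)) (Set.mem_Ici.2 (by positivity))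
    (inv_nonneg.2 hu.le) (inv_nonneg.2 hv.le) huv
  simp only [smul_eq_mul, inv_mul_cancel_left₀ hu.ne', inv_mul_cancel_left₀ hv.ne'] at h
  rw [mul_rpow hu.le ha, mul_rpow hv.le hb] at h
  rw [rpow_sub_one hu.ne', rpow_sub_one hv.ne']
  calc u ^ x / u * a ^ x + v ^ x / v * b ^ x
      = u⁻¹ * (u ^ x * a ^ x) + v⁻¹ * (v ^ x * b ^ x) := by ring
    _ ≤ (a + b) ^ x := h

theorem prod_Icc_one_sub_eq_prod_Ico (f : ℝ → ℝ) (k N : ℕ) :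
    ∏ j ∈ Icc 1 (N - k), f ((N : ℝ) - j) = ∏ i ∈ Ico k N, f i := by
  refine Finset.prod_nbij' (fun j => N - j) (fun i => N - i) ?_ ?_ ?_ ?_ ?_ <;>
    intro j hj <;> simp only [mem_Icc, mem_Ico] at hj ⊢
  · omega
  · omega
  · omega
  · omega
  · rw [Nat.cast_sub (by omega)]

theorem sum_prod_Ico_rpow_le_rpow_sum {s x : ℝ} (hs : 0 < s) (hx0 : 0 ≤ x) (hx1 : x ≤ 1)
    (p : ℕ → ℝ) (n : ℕ) (hp : ∀ i, 1 ≤ i → i ≤ n + 1 → 0 ≤ p i) :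
    ∑ k ∈ Icc 1 (n + 1), (1 + ((k : ℝ) - 1) / s) ^ (x - 1) *
        (∏ i ∈ Ico k (n + 1), (1 + s / (i : ℝ)) ^ (x - 1)) * p k ^ x ≤
      (∑ i ∈ Icc 1 (n + 1), p i) ^ x := by
  induction n with
  | zero => simp
  | succ n ih =>
    have ih := ih fun i h1 h2 => hp i h1 (by omega)
    have hn : (0 : ℝ) < (n : ℝ) + 1 := by positivity
    have hS : 0 ≤ ∑ i ∈ Icc 1 (n + 1), p i :=
      sum_nonneg fun i hi => hp i (mem_Icc.1 hi).1 ((mem_Icc.1 hi).2.trans (by omega))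
    have hu : 0 < 1 + s / ((n : ℝ) + 1) := by positivity
    have hv : 0 < 1 + ((n : ℝ) + 1) / s := by positivity
    have huv : (1 + s / ((n : ℝ) + 1))⁻¹ + (1 + ((n : ℝ) + 1) / s)⁻¹ = 1 := by
      field_simp
      ring
    have key := rpow_sub_one_mul_add_le_add_rpow hu hv huv hS
      (hp (n + 1 + 1) (by omega) le_rfl) hx0 hx1
    rw [sum_Icc_succ_top (by omega), sum_Icc_succ_top (by omega) p]
    refine le_trans (add_le_add ?_ ?_) key
    · refine le_trans (le_of_eq ?_) (mul_le_mul_of_nonneg_left ih (rpow_nonneg hu.le _))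
      rw [mul_sum]
      refine sum_congr rfl fun k hk => ?_
      rw [prod_Ico_succ_top (mem_Icc.1 hk).2]
      push_cast
      ring
    · simp

/-- Lemma 2.2: parameterized lower bound for the `x`-th power (`0 ≤ x ≤ 1`) of a sum of
decreasing positive reals.  The hypothesis `hrs` says `r ≤ s` where
`r = max_{h=1,…,N−1} h p_{h+1}/(p_1+⋯+p_h)`. -/
theorem sum_rpow_lower_bound (N : ℕ) (hN : 2 ≤ N) (p : ℕ → ℝ) (x s : ℝ)
    (hpos : ∀ i, 1 ≤ i → i ≤ N → 0 < p i)
    (hdec : ∀ i, 1 ≤ i → i < N → p (i + 1) ≤ p i)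
    (hx0 : 0 ≤ x) (hx1 : x ≤ 1)
    (hrs : ∀ h, 1 ≤ h → h ≤ N - 1 →
      (h : ℝ) * p (h + 1) / (∑ i ∈ Icc 1 h, p i) ≤ s)
    (hs1 : s ≤ 1) :
    (∑ i ∈ Icc 1 N, p i) ^ x ≥
      (∑ k ∈ Icc 1 (N - 1), (1 + ((k : ℝ) - 1) / s) ^ (x - 1) *
          (∏ j ∈ Icc 1 (N - k), (1 + s / ((N : ℝ) - (j : ℝ))) ^ (x - 1)) * p k ^ x) +
        (1 + ((N : ℝ) - 1) / s) ^ (x - 1) * p N ^ x := by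
  have hs : 0 < s := by
    have h := hrs 1 le_rfl (by omega)
    have h1 := hpos 1 le_rfl (by omega)
    have h2 := hpos 2 (by omega) hN
    refine lt_of_lt_of_le ?_ h
    simp only [Icc_self, sum_singleton, Nat.cast_one, one_mul]
    exact div_pos h2 h1
  obtain ⟨n, rfl⟩ : ∃ n, N = n + 1 := ⟨N - 1, by omega⟩
  have key := sum_prod_Ico_rpow_le_rpow_sum hs hx0 hx1 p n fun i h1 h2 => (hpos i h1 h2).le
  refine le_trans (le_of_eq ?_) key
  rw [sum_Icc_succ_top (by omega), Nat.add_sub_cancel]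
  congr 1
  · refine sum_congr rfl fun k _ => ?_
    rw [prod_Icc_one_sub_eq_prod_Ico (fun t => (1 + s / t) ^ (x - 1))]
  · simp
end

section
/- Let a, t, x, s be real numbers with a ≥ 1, t ≥ a, x ≥ 1, and a/t ≤ s ≤ 1. Then (1+t)^x ≤ (1 + a/s)^(x−1) + (1 + s/a)^(x−1)·t^x. -/
open Real

/-- Jensen's inequality for `y ↦ y ^ x`, with weights `u⁻¹` and `v⁻¹`. -/
theorem one_add_rpow_le_of_inv_add_inv_eq_one {u v t x : ℝ} (hu : 0 < u) (hv : 0 < v)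
    (huv : u⁻¹ + v⁻¹ = 1) (ht : 0 ≤ t) (hx : 1 ≤ x) :
    (1 + t) ^ x ≤ u ^ (x - 1) + v ^ (x - 1) * t ^ x := by
  have h := (convexOn_rpow hx).2 (Set.mem_Ici.2 hu.le) (Set.mem_Ici.2 (by positivity : 0 ≤ v * t))
    (by positivity) (by positivity) huv
  simp only [smul_eq_mul, inv_mul_cancel₀ hu.ne', inv_mul_cancel_left₀ hv.ne',
    Real.mul_rpow hv.le ht] at h
  rw [rpow_sub_one hu.ne', rpow_sub_one hv.ne']
  exact h.trans_eq (by ring)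

/-- Lemma 3.1, first inequality: parameterized upper binomial estimate for `x ≥ 1`. -/
theorem param_binomial_upper_first (a t x s : ℝ) (ha : 1 ≤ a) (hta : a ≤ t)
    (hx : 1 ≤ x) (hs0 : a / t ≤ s) (hs1 : s ≤ 1) :
    (1 + t) ^ x ≤ (1 + a / s) ^ (x - 1) + (1 + s / a) ^ (x - 1) * t ^ x := by
  have ha0 : 0 < a := by linarith
  have ht : 0 < t := by linarith
  have hs : 0 < s := (div_pos ha0 ht).trans_le hs0
  refine one_add_rpow_le_of_inv_add_inv_eq_one (by positivity) (by positivity) ?_ ht.le hx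
  field_simp
  ring
end

section
/- Let a, t, x, s be real numbers with a ≥ 1, t ≥ a, x ≥ 1, and a/t ≤ s ≤ 1. Then (1 + a/s)^(x−1) + (1 + s/a)^(x−1)·t^x ≤ (1 + a)^(x−1) + (1 + 1/a)^(x−1)·t^x. -/
open Real

/-- Jensen's inequality for `y ↦ y ^ x` at the points `s` and `1` with weights proportional to
`1` and `a`. -/
lemma add_rpow_le_mul_rpow_add {a s x : ℝ} (ha : 0 < a) (hs : 0 < s) (hx : 1 ≤ x) :
    (s + a) ^ (x - 1) * (s + a) ≤ (1 + a) ^ (x - 1) * (s ^ (x - 1) * s + a) := by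
  have ha1 : 0 < 1 + a := by positivity
  have hsa : 0 < s + a := by positivity
  have h := (convexOn_rpow hx).2 (Set.mem_Ici.2 hs.le) (Set.mem_Ici.2 zero_le_one)
    (show 0 ≤ 1 / (1 + a) by positivity) (show 0 ≤ a / (1 + a) by positivity) (by field_simp)
  simp only [smul_eq_mul, one_rpow, mul_one] at h
  rw [show 1 / (1 + a) * s + a / (1 + a) = (s + a) / (1 + a) by ring,
    show 1 / (1 + a) * s ^ x + a / (1 + a) = (s ^ x + a) / (1 + a) by ring,
    div_rpow hsa.le ha1.le, div_le_div_iff₀ (by positivity) ha1] at h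
  have split : ∀ {y : ℝ}, 0 < y → y ^ x = y ^ (x - 1) * y := fun hy => by
    rw [rpow_sub_one hy.ne', div_mul_cancel₀ _ hy.ne']
  rw [split hsa, split hs, split ha1] at h
  refine le_of_mul_le_mul_right (h.trans_eq ?_) ha1
  ring

/-- Lemma 3.1, second inequality: the parameterized upper bound with `s ≤ 1`
is at most the bound at `s = 1`. -/
theorem param_binomial_upper_second (a t x s : ℝ) (ha : 1 ≤ a) (hta : a ≤ t)
    (hx : 1 ≤ x) (hs0 : a / t ≤ s) (hs1 : s ≤ 1) :
    (1 + a / s) ^ (x - 1) + (1 + s / a) ^ (x - 1) * t ^ x ≤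
      (1 + a) ^ (x - 1) + (1 + 1 / a) ^ (x - 1) * t ^ x := by
  have ha0 : 0 < a := by linarith
  have ht0 : 0 < t := by linarith
  have hs : 0 < s := (div_pos ha0 ht0).trans_le hs0
  have hconv := add_rpow_le_mul_rpow_add ha0 hs hx
  have hmono : (s + a) ^ (x - 1) ≤ (1 + a) ^ (x - 1) :=
    rpow_le_rpow (by positivity) (by linarith) (by linarith)
  have hT : a ^ (x - 1) * a / (s ^ (x - 1) * s) ≤ t ^ x := by
    have h : (a / s) ^ x ≤ t ^ x :=
      rpow_le_rpow (by positivity) ((div_le_comm₀ ht0 hs).1 hs0) (by linarith)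
    rwa [div_rpow ha0.le hs.le, ← sub_add_cancel x 1, rpow_add_one ha0.ne',
      rpow_add_one hs.ne', sub_add_cancel] at h
  rw [show 1 + a / s = (s + a) / s by field_simp, show 1 + s / a = (s + a) / a by field_simp; ring,
    show 1 + 1 / a = (1 + a) / a by field_simp; ring, div_rpow (by positivity) hs.le,
    div_rpow (by positivity) ha0.le, div_rpow (by positivity) ha0.le]
  have hS : 0 < s ^ (x - 1) := by positivity
  have hC : 0 < a ^ (x - 1) := by positivity
  generalize (s + a) ^ (x - 1) = A at *
  generalize (1 + a) ^ (x - 1) = B at *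
  generalize s ^ (x - 1) = S at *
  generalize a ^ (x - 1) = C at *
  generalize t ^ x = T at *
  have h₁ : (B - A) / C * (C * a / (S * s)) ≤ (B - A) / C * T :=
    mul_le_mul_of_nonneg_left hT (div_nonneg (sub_nonneg.2 hmono) hC.le)
  have h₂ : A / S - B ≤ (B - A) / C * (C * a / (S * s)) := by
    rw [show (B - A) / C * (C * a / (S * s)) = (B - A) * a / (S * s) by field_simp,
      le_div_iff₀ (by positivity),
      show (A / S - B) * (S * s) = A * s - B * S * s by field_simp]
    linarith
  have h₃ : (B - A) / C * T = B / C * T - A / C * T := by ring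
  linarith
end

section
/- Let a, t, x be real numbers with a ≥ 1, t ≥ a, and x ≥ 1. Then (1 + a)^(x−1) + (1 + 1/a)^(x−1)·t^x ≤ 1 + (((1+a)^x − 1)/a^x)·t^x. -/
open Real

/-- Lemma 3.1, third inequality. -/
theorem binomial_upper_third (a t x : ℝ) (ha : 1 ≤ a) (hta : a ≤ t) (hx : 1 ≤ x) :
    (1 + a) ^ (x - 1) + (1 + 1 / a) ^ (x - 1) * t ^ x ≤
      1 + (((1 + a) ^ x - 1) / a ^ x) * t ^ x := by
  have ha0 : 0 < a := by linarith
  have hA : 1 ≤ (1 + a) ^ (x - 1) := one_le_rpow (by linarith) (by linarith)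
  have hP : 0 < a ^ x := rpow_pos_of_pos ha0 x
  have hs : 1 ≤ t ^ x / a ^ x :=
    (one_le_div hP).2 (rpow_le_rpow ha0.le hta (by linarith))
  have h1 : (1 + a) ^ x = (1 + a) ^ (x - 1) * (1 + a) := by
    rw [rpow_sub_one (by linarith), div_mul_cancel₀ _ (by linarith)]
  have h2 : (1 + 1 / a) ^ (x - 1) = (1 + a) ^ (x - 1) * a / a ^ x := by
    rw [show 1 + 1 / a = (1 + a) / a by field_simp; ring,
      div_rpow (by linarith) ha0.le, rpow_sub_one ha0.ne' x]
    field_simp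
  have key : 1 + (((1 + a) ^ x - 1) / a ^ x) * t ^ x
      - ((1 + a) ^ (x - 1) + (1 + 1 / a) ^ (x - 1) * t ^ x)
      = ((1 + a) ^ (x - 1) - 1) * (t ^ x / a ^ x - 1) := by
    rw [h1, h2]
    ring
  have := mul_nonneg (sub_nonneg.2 hA) (sub_nonneg.2 hs)
  linarith
end

section
/- Let N ≥ 2 be an integer, let p_1 ≥ p_2 ≥ ⋯ ≥ p_N > 0 be real numbers, let x ≥ 1 be real, and set r = max over h = 1, …, N−1 of h·p_{h+1}/(p_1 + ⋯ + p_h). Then for every real s with r ≤ s ≤ 1: (∑_{i=1}^{N} p_i)^x ≤ ∑_{k=1}^{N−1} (1 + (k−1)/s)^(x−1) · ∏_{j=1}^{N−k} (1 + s/(N−j))^(x−1) · p_k^x + (1 + (N−1)/s)^(x−1) · p_N^x. -/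
open Real Finset

/-- Convexity of `t ↦ t ^ x` with weights `u⁻¹` and `v⁻¹`. -/
theorem add_rpow_le_of_inv_add_inv_eq_one {a b u v x : ℝ} (ha : 0 ≤ a) (hb : 0 ≤ b)
    (hu : 0 < u) (hv : 0 < v) (huv : u⁻¹ + v⁻¹ = 1) (hx : 1 ≤ x) :
    (a + b) ^ x ≤ u ^ (x - 1) * a ^ x + v ^ (x - 1) * b ^ x := by
  have h := (convexOn_rpow hx).2 (mul_nonneg hu.le ha) (mul_nonneg hv.le hb)
    (inv_nonneg.2 hu.le) (inv_nonneg.2 hv.le) huv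
  simp only [smul_eq_mul] at h
  rw [inv_mul_cancel_left₀ hu.ne', inv_mul_cancel_left₀ hv.ne',
    Real.mul_rpow hu.le ha, Real.mul_rpow hv.le hb] at h
  rw [Real.rpow_sub_one hu.ne', Real.rpow_sub_one hv.ne']
  exact h.trans_eq (by ring)

/-- The upper bound holds for every `s > 0` and nonnegative summands, without monotonicity. -/
theorem sum_rpow_le_sum_prod_Ico {p : ℕ → ℝ} {x s : ℝ} (hx : 1 ≤ x) (hs : 0 < s)
    {N : ℕ} (hN : 1 ≤ N) (hp : ∀ i, 1 ≤ i → i ≤ N → 0 ≤ p i) :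
    (∑ i ∈ Icc 1 N, p i) ^ x ≤
      ∑ k ∈ Icc 1 N, (1 + ((k : ℝ) - 1) / s) ^ (x - 1) *
        (∏ m ∈ Ico k N, (1 + s / (m : ℝ)) ^ (x - 1)) * p k ^ x := by
  induction N, hN using Nat.le_induction with
  | base => simp
  | succ n hn ih =>
    have hn0 : (0 : ℝ) < n := by exact_mod_cast hn
    rw [sum_Icc_succ_top (by lia), sum_Icc_succ_top (by lia)]
    have hsum : 0 ≤ ∑ i ∈ Icc 1 n, p i :=
      sum_nonneg fun i hi => hp i (mem_Icc.1 hi).1 (by have := (mem_Icc.1 hi).2; lia)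
    refine (add_rpow_le_of_inv_add_inv_eq_one (u := 1 + s / n) (v := 1 + n / s) hsum
      (hp _ (by lia) le_rfl) (by positivity) (by positivity) (by field_simp; ring) hx).trans ?_
    refine add_le_add ?_ (by simp)
    refine (mul_le_mul_of_nonneg_left (ih fun i h1 h2 => hp i h1 (by lia))
      (by positivity)).trans_eq ?_
    rw [mul_sum]
    refine sum_congr rfl fun k hk => ?_
    rw [prod_Ico_succ_top (mem_Icc.1 hk).2]
    ring

/-- Reflecting the index of a product of values at `N - j`. -/
theorem prod_Icc_sub_eq_prod_Ico (f : ℝ → ℝ) {k N : ℕ} (hk : k ≤ N) :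
    ∏ j ∈ Icc 1 (N - k), f ((N : ℝ) - (j : ℝ)) = ∏ m ∈ Ico k N, f (m : ℝ) := by
  refine prod_nbij' (fun j => N - j) (fun m => N - m) ?_ ?_ ?_ ?_ ?_
  · intro j hj; simp only [mem_Icc, mem_Ico] at *; lia
  · intro j hj; simp only [mem_Icc, mem_Ico] at *; lia
  · intro j hj; simp only [mem_Icc] at *; lia
  · intro j hj; simp only [mem_Ico] at *; lia
  · intro j hj
    simp only [mem_Icc] at hj
    rw [Nat.cast_sub (by lia)]

/-- Lemma 3.2: parameterized upper bound for the `x`-th power (`x ≥ 1`) of a sum of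
decreasing positive reals.  The hypothesis `hrs` says `r ≤ s` where
`r = max_{h=1,…,N−1} h p_{h+1}/(p_1+⋯+p_h)`. -/
theorem sum_rpow_upper_bound (N : ℕ) (hN : 2 ≤ N) (p : ℕ → ℝ) (x s : ℝ)
    (hpos : ∀ i, 1 ≤ i → i ≤ N → 0 < p i)
    (hdec : ∀ i, 1 ≤ i → i < N → p (i + 1) ≤ p i)
    (hx : 1 ≤ x)
    (hrs : ∀ h, 1 ≤ h → h ≤ N - 1 →
      (h : ℝ) * p (h + 1) / (∑ i ∈ Icc 1 h, p i) ≤ s)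
    (hs1 : s ≤ 1) :
    (∑ i ∈ Icc 1 N, p i) ^ x ≤
      (∑ k ∈ Icc 1 (N - 1), (1 + ((k : ℝ) - 1) / s) ^ (x - 1) *
          (∏ j ∈ Icc 1 (N - k), (1 + s / ((N : ℝ) - (j : ℝ))) ^ (x - 1)) * p k ^ x) +
        (1 + ((N : ℝ) - 1) / s) ^ (x - 1) * p N ^ x := by
  have hs : 0 < s := by
    have h := hrs 1 le_rfl (by lia)
    have h1 := hpos 1 le_rfl (by lia)
    have h2 := hpos 2 (by lia) hN
    refine lt_of_lt_of_le ?_ h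
    simp only [Nat.cast_one, one_mul, Icc_self, sum_singleton]
    exact div_pos h2 h1
  refine (sum_rpow_le_sum_prod_Ico hx hs (by lia) fun i h1 h2 => (hpos i h1 h2).le).trans_eq ?_
  obtain ⟨n, rfl⟩ : ∃ n, N = n + 1 := ⟨N - 1, by lia⟩
  rw [sum_Icc_succ_top (by lia), Nat.add_sub_cancel, Ico_self, prod_empty, mul_one]
  congr 1
  refine sum_congr rfl fun k hk => ?_
  rw [prod_Icc_sub_eq_prod_Ico (fun y => (1 + s / y) ^ (x - 1))
    ((mem_Icc.1 hk).2.trans n.le_succ)]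
end

section
/- Let δ > 0 and β ≥ δ be reals, let N ≥ 3 be an integer, let E ≥ 0 and E_1 ≥ E_2 ≥ ⋯ ≥ E_{N−1} > 0 be real numbers satisfying E^δ ≤ ∑_{i=1}^{N−1} E_i^δ. Set q̃ = max over h = 1, …, N−2 of h·E_{h+1}^δ/(E_1^δ + ⋯ + E_h^δ), and let s be real with q̃ ≤ s ≤ 1. Then E^β ≤ ∑_{k=1}^{N−2} (1 + (k−1)/s)^(β/δ − 1) · ∏_{j=2}^{N−k} (1 + s/(N−j))^(β/δ − 1) · E_k^β + (1 + (N−2)/s)^(β/δ − 1) · E_{N−1}^β. -/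
open Real Finset

/-- Convexity of `x ↦ x ^ γ` in terms of reciprocal weights. -/
lemma add_rpow_le_of_inv_add_inv_eq_one_s12 {a b x y γ : ℝ} (ha : 0 < a) (hb : 0 < b)
    (hab : a⁻¹ + b⁻¹ = 1) (hx : 0 ≤ x) (hy : 0 ≤ y) (hγ : 1 ≤ γ) :
    (x + y) ^ γ ≤ a ^ (γ - 1) * x ^ γ + b ^ (γ - 1) * y ^ γ := by
  have h := (convexOn_rpow hγ).2 (mul_nonneg ha.le hx) (mul_nonneg hb.le hy)
    (inv_nonneg.mpr ha.le) (inv_nonneg.mpr hb.le) hab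
  simp only [smul_eq_mul] at h
  rw [inv_mul_cancel_left₀ ha.ne', inv_mul_cancel_left₀ hb.ne',
    Real.mul_rpow ha.le hx, Real.mul_rpow hb.le hy] at h
  refine h.trans_eq ?_
  rw [Real.rpow_sub_one ha.ne', Real.rpow_sub_one hb.ne']
  ring

/-- Iterated weighted convexity bound for the power of a finite sum. -/
lemma sum_rpow_le_sum_weighted_rpow {s γ : ℝ} (hs : 0 < s) (hγ : 1 ≤ γ) (x : ℕ → ℝ) (n : ℕ)
    (hx : ∀ i ∈ Icc 1 (n + 1), 0 ≤ x i) :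
    (∑ i ∈ Icc 1 (n + 1), x i) ^ γ ≤
      ∑ k ∈ Icc 1 (n + 1), (1 + ((k : ℝ) - 1) / s) ^ (γ - 1) *
        (∏ m ∈ Ico k (n + 1), (1 + s / (m : ℝ)) ^ (γ - 1)) * x k ^ γ := by
  induction n with
  | zero => simp
  | succ n ih =>
    have hx' : ∀ i ∈ Icc 1 (n + 1), 0 ≤ x i := fun i hi =>
      hx i (Icc_subset_Icc_right (Nat.le_succ _) hi)
    rw [sum_Icc_succ_top (b := n + 1) (by lia), sum_Icc_succ_top (b := n + 1) (by lia)]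
    have hn : (0 : ℝ) < ((n + 1 : ℕ) : ℝ) := by positivity
    have key := add_rpow_le_of_inv_add_inv_eq_one_s12
      (a := 1 + s / ((n + 1 : ℕ) : ℝ)) (b := 1 + ((n + 1 : ℕ) : ℝ) / s)
      (by positivity) (by positivity) (by field_simp; ring) (sum_nonneg hx')
      (hx (n + 1 + 1) (by simp)) hγ
    refine key.trans (add_le_add ?_ ?_)
    · refine (mul_le_mul_of_nonneg_left (ih hx') (by positivity)).trans_eq ?_
      rw [mul_sum]
      refine sum_congr rfl fun k hk => ?_
      rw [prod_Ico_succ_top (mem_Icc.mp hk).2]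
      ring
    · simp

/-- Theorem 3.1 (real-variable content): tighter polygamy relation for the `β`-th power
(`β ≥ δ`).  `E` plays the role of `𝓔_a(ρ_{A|B_1⋯B_{N−1}})` and `Ei 1 ≥ ⋯ ≥ Ei (N−1) > 0`
are the values `𝓔_a(ρ_{AB_i})` arranged in descending order; `hpoly` is the `δ`-th polygamy
relation and `hqs` says `q̃ ≤ s` where
`q̃ = max_{h=1,…,N−2} h 𝓔_{a_{h+1}}^δ/(𝓔_{a_1}^δ+⋯+𝓔_{a_h}^δ)`. -/
theorem polygamy_beta_ge_delta (δ β : ℝ) (hδ : 0 < δ) (hβδ : δ ≤ β)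
    (N : ℕ) (hN : 3 ≤ N) (E : ℝ) (Ei : ℕ → ℝ) (hE : 0 ≤ E)
    (hpos : ∀ i, 1 ≤ i → i ≤ N - 1 → 0 < Ei i)
    (hdec : ∀ i, 1 ≤ i → i < N - 1 → Ei (i + 1) ≤ Ei i)
    (hpoly : E ^ δ ≤ ∑ i ∈ Icc 1 (N - 1), Ei i ^ δ)
    (s : ℝ)
    (hqs : ∀ h, 1 ≤ h → h ≤ N - 2 →
      (h : ℝ) * Ei (h + 1) ^ δ / (∑ i ∈ Icc 1 h, Ei i ^ δ) ≤ s)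
    (hs1 : s ≤ 1) :
    E ^ β ≤
      (∑ k ∈ Icc 1 (N - 2), (1 + ((k : ℝ) - 1) / s) ^ (β / δ - 1) *
          (∏ j ∈ Icc 2 (N - k), (1 + s / ((N : ℝ) - (j : ℝ))) ^ (β / δ - 1)) * Ei k ^ β) +
        (1 + ((N : ℝ) - 2) / s) ^ (β / δ - 1) * Ei (N - 1) ^ β := by
  obtain ⟨n, rfl⟩ : ∃ n, N = n + 2 := ⟨N - 2, by lia⟩
  simp only [Nat.add_sub_cancel, show n + 2 - 1 = n + 1 by lia] at *
  have hs : 0 < s := by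
    refine lt_of_lt_of_le ?_ (hqs 1 le_rfl (by lia))
    have h1 := hpos 1 le_rfl (by lia)
    have h2 := hpos 2 (by lia) (by lia)
    simp only [Icc_self, sum_singleton]
    positivity
  have hγ : 1 ≤ β / δ := (one_le_div hδ).mpr hβδ
  have hpow : ∀ {y : ℝ}, 0 ≤ y → (y ^ δ) ^ (β / δ) = y ^ β := fun hy => by
    rw [← Real.rpow_mul hy, mul_div_cancel₀ _ hδ.ne']
  have hEi : ∀ i ∈ Icc 1 (n + 1), 0 ≤ Ei i := fun i hi =>
    (hpos i (mem_Icc.mp hi).1 (mem_Icc.mp hi).2).le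
  calc
    E ^ β = (E ^ δ) ^ (β / δ) := (hpow hE).symm
    _ ≤ (∑ i ∈ Icc 1 (n + 1), Ei i ^ δ) ^ (β / δ) :=
      Real.rpow_le_rpow (by positivity) hpoly (by linarith)
    _ ≤ _ := sum_rpow_le_sum_weighted_rpow hs hγ _ n
      fun i hi => Real.rpow_nonneg (hEi i hi) δ
    _ = _ := by
      rw [sum_Icc_succ_top (by lia)]
      congr 1
      · refine sum_congr rfl fun k hk => ?_
        have hk' := mem_Icc.mp hk
        rw [hpow (hEi k (Icc_subset_Icc_right (Nat.le_succ _) hk))]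
        congr 2
        refine prod_bij' (fun m _ => n + 2 - m) (fun j _ => n + 2 - j) ?_ ?_ ?_ ?_ ?_
        · intro m hm
          simp only [mem_Ico, mem_Icc] at *
          lia
        · intro m hm
          simp only [mem_Ico, mem_Icc] at *
          lia
        · intro m hm
          simp only [mem_Ico] at *
          lia
        · intro m hm
          simp only [mem_Icc] at *
          lia
        · intro m hm
          have hm' : m ≤ n + 2 := by have := mem_Ico.mp hm; lia
          rw [Nat.cast_sub hm', sub_sub_cancel]
      · rw [hpow (hEi (n + 1) (by simp)), Ico_self, prod_empty, mul_one]
        push_cast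
        congr 3
        ring
end

section
/- Let δ > 0 and β ≥ δ be reals with x = β/δ, let N ≥ 3 be an integer, let E ≥ 0 and E_1 ≥ E_2 ≥ ⋯ ≥ E_{N−1} > 0 be real numbers satisfying E^δ ≤ ∑_{i=1}^{N−1} E_i^δ, let q̃ = max over h = 1, …, N−2 of h·E_{h+1}^δ/(E_1^δ + ⋯ + E_h^δ), and let q̃ ≤ s ≤ 1. Then the following chain of inequalities holds: ∑_{k=1}^{N−2} (1+(k−1)/s)^(x−1) ∏_{j=2}^{N−k} (1+s/(N−j))^(x−1) E_k^β + (1+(N−2)/s)^(x−1) E_{N−1}^β ≤ ∑_{k=1}^{N−2} k^(x−1) ∏_{j=2}^{N−k} (1+1/(N−j))^(x−1) E_k^β + (N−1)^(x−1) E_{N−1}^β ≤ ∑_{k=1}^{N−2} ∏_{j=2}^{N−k} (((N−j+1)^x − 1)/(N−j)^x) E_k^β + E_{N−1}^β ≤ ∑_{k=1}^{N−1} (2^x − 1)^(N−1−k) E_k^β. -/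
open Real Finset

/-- The solution of the recursion `S (n + 1) = c n * S n + d (n + 1) * y (n + 1)`, `S 0 = 0`,
written in closed form. -/
noncomputable def recursiveSum (c d y : ℕ → ℝ) (n : ℕ) : ℝ :=
  ∑ k ∈ Icc 1 n, d k * (∏ h ∈ Ico k n, c h) * y k

lemma recursiveSum_one (c d y : ℕ → ℝ) : recursiveSum c d y 1 = d 1 * y 1 := by
  simp [recursiveSum]

lemma recursiveSum_succ (c d y : ℕ → ℝ) (n : ℕ) :
    recursiveSum c d y (n + 1) = c n * recursiveSum c d y n + d (n + 1) * y (n + 1) := by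
  unfold recursiveSum
  rw [sum_Icc_succ_top (by omega), mul_sum]
  congr 1
  · refine sum_congr rfl fun k hk => ?_
    rw [prod_Ico_succ_top (mem_Icc.1 hk).2]
    ring
  · simp

lemma recursiveSum_le_recursiveSum {c d c' d' y : ℕ → ℝ} {n : ℕ} (hn : 1 ≤ n)
    (h_one : d 1 = d' 1) (hc : ∀ h, 1 ≤ h → h < n → 0 ≤ c' h)
    (hstep : ∀ h, 1 ≤ h → h < n →
      c h * recursiveSum c d y h + d (h + 1) * y (h + 1) ≤
        c' h * recursiveSum c d y h + d' (h + 1) * y (h + 1)) :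
    recursiveSum c d y n ≤ recursiveSum c' d' y n := by
  induction n, hn using Nat.le_induction with
  | base => simp [recursiveSum_one, h_one]
  | succ n hn ih =>
    have h₁ := ih (fun h h1 h2 => hc h h1 (by omega)) (fun h h1 h2 => hstep h h1 (by omega))
    have h₂ := hstep n hn (by omega)
    have h₃ := mul_le_mul_of_nonneg_left h₁ (hc n hn (by omega))
    rw [recursiveSum_succ, recursiveSum_succ]
    linarith

lemma prod_Icc_two_sub (f : ℝ → ℝ) {N k : ℕ} (hk : 1 ≤ k) (hkN : k + 1 ≤ N) :
    ∏ j ∈ Icc 2 (N - k), f ((N : ℝ) - (j : ℝ)) = ∏ h ∈ Ico k (N - 1), f (h : ℝ) := by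
  refine prod_nbij' (fun j => N - j) (fun h => N - h) ?_ ?_ ?_ ?_ ?_
  · intro j hj; simp only [mem_Icc, mem_Ico] at *; omega
  · intro j hj; simp only [mem_Icc, mem_Ico] at *; omega
  · intro j hj; simp only [mem_Icc] at *; omega
  · intro j hj; simp only [mem_Ico] at *; omega
  · intro j hj
    simp only [mem_Icc] at hj
    rw [Nat.cast_sub (by omega)]

lemma recursiveSum_pred_eq (f g : ℝ → ℝ) (y : ℕ → ℝ) {N : ℕ} (hN : 2 ≤ N) :
    recursiveSum (fun h => f h) (fun k => g k) y (N - 1) =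
      (∑ k ∈ Icc 1 (N - 2), g k * (∏ j ∈ Icc 2 (N - k), f ((N : ℝ) - (j : ℝ))) * y k) +
        g ((N : ℝ) - 1) * y (N - 1) := by
  obtain ⟨n, rfl⟩ : ∃ n, N = n + 2 := ⟨N - 2, by omega⟩
  have hlast : ((n + 2 : ℕ) : ℝ) - 1 = ((n + 1 : ℕ) : ℝ) := by push_cast; ring
  rw [hlast]
  change recursiveSum _ _ _ (n + 1) = _
  unfold recursiveSum
  rw [sum_Icc_succ_top (by omega)]
  congr 1
  · refine sum_congr rfl fun k hk => ?_
    have hk' := mem_Icc.1 hk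
    rw [prod_Icc_two_sub f hk'.1 (by omega)]
    rfl
  · simp

/-- Jensen's inequality for `t ↦ t ^ x` with weights `h / (h + s)` and `s / (h + s)`. -/
lemma add_rpow_le_weighted {x h s a b : ℝ} (hx : 1 ≤ x) (hh : 0 < h) (hs : 0 < s)
    (ha : 0 ≤ a) (hb : 0 ≤ b) :
    (a + b) ^ x ≤ (1 + s / h) ^ (x - 1) * a ^ x + (1 + h / s) ^ (x - 1) * b ^ x := by
  have hu : 0 < 1 + s / h := by positivity
  have hv : 0 < 1 + h / s := by positivity
  have key := (convexOn_rpow hx).2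
    (show (1 + s / h) * a ∈ Set.Ici 0 from mul_nonneg hu.le ha)
    (show (1 + h / s) * b ∈ Set.Ici 0 from mul_nonneg hv.le hb)
    (inv_pos.2 hu).le (inv_pos.2 hv).le (by field_simp; ring)
  simp only [smul_eq_mul] at key
  rw [inv_mul_cancel_left₀ hu.ne', inv_mul_cancel_left₀ hv.ne', mul_rpow hu.le ha,
    mul_rpow hv.le hb, ← mul_assoc, ← mul_assoc] at key
  rw [rpow_sub_one hu.ne', rpow_sub_one hv.ne', div_eq_inv_mul _ (1 + s / h),
    div_eq_inv_mul _ (1 + h / s)]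
  exact key

lemma weighted_step_le_one {x h s B b : ℝ} (hx : 1 ≤ x) (hh : 0 < h) (hs : 0 < s) (hs1 : s ≤ 1)
    (hb : 0 ≤ b) (hB : (h / s) ^ x * b ≤ B) :
    (1 + s / h) ^ (x - 1) * B + (1 + h / s) ^ (x - 1) * b ≤
      (1 + 1 / h) ^ (x - 1) * B + (1 + h / 1) ^ (x - 1) * b := by
  have hr : 0 < h / s := by positivity
  have hmono : (1 + s / h) ^ (x - 1) ≤ (1 + 1 / h) ^ (x - 1) := by
    apply rpow_le_rpow (by positivity) (by gcongr) (by linarith)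
  have hJ := add_rpow_le_weighted hx hh one_pos hr.le zero_le_one
  rw [one_rpow, mul_one] at hJ
  have heq : (h / s + 1) ^ x =
      (1 + s / h) ^ (x - 1) * (h / s) ^ x + (1 + h / s) ^ (x - 1) := by
    have h₁ : (h / s) ^ x = (h / s) ^ (x - 1) * (h / s) := by
      rw [rpow_sub_one hr.ne']; field_simp
    have h₂ : (h / s + 1) ^ x = (1 + h / s) ^ (x - 1) * (1 + h / s) := by
      rw [add_comm, rpow_sub_one (by positivity)]; field_simp
    have h₃ : (1 + s / h) ^ (x - 1) * (h / s) ^ (x - 1) = (1 + h / s) ^ (x - 1) := by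
      rw [← mul_rpow (by positivity) hr.le]
      congr 1
      field_simp
      ring
    rw [h₁, h₂, ← mul_assoc, h₃]
    ring
  rw [heq] at hJ
  have h₁ := mul_le_mul_of_nonneg_right hJ hb
  have h₂ := mul_le_mul_of_nonneg_left hB (sub_nonneg.2 hmono)
  linarith

lemma weighted_step_le_prod {x h B b : ℝ} (hx : 1 ≤ x) (hh : 0 < h) (hB : h ^ x * b ≤ B) :
    (1 + 1 / h) ^ (x - 1) * B + (1 + h / 1) ^ (x - 1) * b ≤
      ((h + 1) ^ x - 1) / h ^ x * B + b := by
  have hp : 1 ≤ (h + 1) ^ (x - 1) := one_le_rpow (by linarith) (by linarith)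
  have hhx : 0 < h ^ x := by positivity
  have h₁ : (1 + 1 / h) ^ (x - 1) = (h + 1) ^ (x - 1) * h / h ^ x := by
    rw [show 1 + 1 / h = (h + 1) / h by field_simp, div_rpow (by positivity) hh.le,
      rpow_sub_one hh.ne']
    field_simp
  have h₂ : (h + 1) ^ x = (h + 1) ^ (x - 1) * (h + 1) := by
    rw [rpow_sub_one (by positivity)]; field_simp
  have h₃ : b ≤ B / h ^ x := by
    rw [le_div_iff₀ hhx]; linarith
  have h₄ := mul_le_mul_of_nonneg_left h₃ (sub_nonneg.2 hp)
  rw [h₁, h₂, div_one, add_comm 1 h]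
  have h₅ : ((h + 1) ^ (x - 1) * (h + 1) - 1) / h ^ x * B - (h + 1) ^ (x - 1) * h / h ^ x * B =
      ((h + 1) ^ (x - 1) - 1) * (B / h ^ x) := by ring
  linarith

lemma one_add_rpow_add_one_le {x t : ℝ} (hx : 1 ≤ x) (ht : 0 ≤ t) (ht1 : t ≤ 1) :
    (1 + t) ^ x + 1 ≤ 2 ^ x + t ^ x := by
  have h2 : 0 < 2 - t := by linarith
  have hu : 0 ≤ 1 / (2 - t) := by positivity
  have hv : 0 ≤ (1 - t) / (2 - t) := div_nonneg (by linarith) h2.le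
  have huv : 1 / (2 - t) + (1 - t) / (2 - t) = 1 := by field_simp; ring
  have k₁ := (convexOn_rpow hx).2 (x := t) (y := 2) (Set.mem_Ici.2 ht)
    (Set.mem_Ici.2 (by norm_num)) hu hv huv
  have k₂ := (convexOn_rpow hx).2 (x := t) (y := 2) (Set.mem_Ici.2 ht)
    (Set.mem_Ici.2 (by norm_num)) hv hu (by linarith)
  simp only [smul_eq_mul] at k₁ k₂
  rw [show 1 / (2 - t) * t + (1 - t) / (2 - t) * 2 = 1 by field_simp; ring, one_rpow] at k₁
  rw [show (1 - t) / (2 - t) * t + 1 / (2 - t) * 2 = 1 + t by field_simp; ring] at k₂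
  have h₁ : (1 - t) / (2 - t) = 1 - 1 / (2 - t) := by linarith
  rw [h₁] at k₁ k₂
  linarith

lemma prod_coeff_le {x h : ℝ} (hx : 1 ≤ x) (hh : 1 ≤ h) :
    ((h + 1) ^ x - 1) / h ^ x ≤ 2 ^ x - 1 := by
  have h0 : 0 < h := by linarith
  have key := one_add_rpow_add_one_le hx (t := 1 / h) (by positivity)
    (by rw [div_le_one h0]; exact hh)
  rw [show 1 + 1 / h = (h + 1) / h by field_simp, div_rpow (by positivity) h0.le,
    div_rpow zero_le_one h0.le, one_rpow] at key
  rw [sub_div]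
  linarith

lemma rpow_sum_le_recursiveSum {x s : ℝ} (hx : 1 ≤ x) (hs : 0 < s) (e : ℕ → ℝ) {n : ℕ}
    (hn : 1 ≤ n) (he : ∀ i, 1 ≤ i → i ≤ n → 0 ≤ e i) :
    (∑ i ∈ Icc 1 n, e i) ^ x ≤
      recursiveSum (fun h => (1 + s / (h : ℝ)) ^ (x - 1))
        (fun k => (1 + ((k : ℝ) - 1) / s) ^ (x - 1)) (fun k => e k ^ x) n := by
  induction n, hn using Nat.le_induction with
  | base => simp [recursiveSum_one]
  | succ n hn ih =>
    have hn0 : (0 : ℝ) < n := by exact_mod_cast hn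
    rw [recursiveSum_succ, sum_Icc_succ_top (by omega)]
    have h₁ := add_rpow_le_weighted hx hn0 hs
      (sum_nonneg (s := Icc 1 n) fun i hi => he i (mem_Icc.1 hi).1 (by have := (mem_Icc.1 hi).2; omega))
      (he (n + 1) (by omega) le_rfl)
    have h₂ := mul_le_mul_of_nonneg_left (ih fun i h1 h2 => he i h1 (by omega))
      (show 0 ≤ (1 + s / (n : ℝ)) ^ (x - 1) by positivity)
    have h₃ : ((n + 1 : ℕ) : ℝ) - 1 = n := by push_cast; ring
    simp only [h₃]
    linarith

/-- Comparison of the polygamy upper bounds displayed after Theorem 3.1: the parameterized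
bound is dominated by the `s = 1` bound, which is dominated by the product-coefficient
bound, which is dominated by the classical bound with coefficients `(2^(β/δ) − 1)^(N−1−k)`. -/
theorem polygamy_bounds_comparison (δ β x : ℝ) (hδ : 0 < δ) (hβδ : δ ≤ β)
    (hx : x = β / δ)
    (N : ℕ) (hN : 3 ≤ N) (E : ℝ) (Ei : ℕ → ℝ) (hE : 0 ≤ E)
    (hpos : ∀ i, 1 ≤ i → i ≤ N - 1 → 0 < Ei i)
    (hdec : ∀ i, 1 ≤ i → i < N - 1 → Ei (i + 1) ≤ Ei i)
    (hpoly : E ^ δ ≤ ∑ i ∈ Icc 1 (N - 1), Ei i ^ δ)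
    (s : ℝ)
    (hqs : ∀ h, 1 ≤ h → h ≤ N - 2 →
      (h : ℝ) * Ei (h + 1) ^ δ / (∑ i ∈ Icc 1 h, Ei i ^ δ) ≤ s)
    (hs1 : s ≤ 1) :
    ((∑ k ∈ Icc 1 (N - 2), (1 + ((k : ℝ) - 1) / s) ^ (x - 1) *
          (∏ j ∈ Icc 2 (N - k), (1 + s / ((N : ℝ) - (j : ℝ))) ^ (x - 1)) * Ei k ^ β) +
        (1 + ((N : ℝ) - 2) / s) ^ (x - 1) * Ei (N - 1) ^ β ≤
      (∑ k ∈ Icc 1 (N - 2), (k : ℝ) ^ (x - 1) *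
          (∏ j ∈ Icc 2 (N - k), (1 + 1 / ((N : ℝ) - (j : ℝ))) ^ (x - 1)) * Ei k ^ β) +
        ((N : ℝ) - 1) ^ (x - 1) * Ei (N - 1) ^ β) ∧
    ((∑ k ∈ Icc 1 (N - 2), (k : ℝ) ^ (x - 1) *
          (∏ j ∈ Icc 2 (N - k), (1 + 1 / ((N : ℝ) - (j : ℝ))) ^ (x - 1)) * Ei k ^ β) +
        ((N : ℝ) - 1) ^ (x - 1) * Ei (N - 1) ^ β ≤
      (∑ k ∈ Icc 1 (N - 2),
          (∏ j ∈ Icc 2 (N - k),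
            (((N : ℝ) - (j : ℝ) + 1) ^ x - 1) / ((N : ℝ) - (j : ℝ)) ^ x) * Ei k ^ β) +
        Ei (N - 1) ^ β) ∧
    ((∑ k ∈ Icc 1 (N - 2),
          (∏ j ∈ Icc 2 (N - k),
            (((N : ℝ) - (j : ℝ) + 1) ^ x - 1) / ((N : ℝ) - (j : ℝ)) ^ x) * Ei k ^ β) +
        Ei (N - 1) ^ β ≤
      ∑ k ∈ Icc 1 (N - 1), ((2 : ℝ) ^ x - 1) ^ (N - 1 - k) * Ei k ^ β) := by
  have hx1 : 1 ≤ x := by rw [hx, le_div_iff₀ hδ]; linarith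
  set e : ℕ → ℝ := fun i => Ei i ^ δ with he
  have hepos : ∀ i, 1 ≤ i → i ≤ N - 1 → 0 < e i := fun i h1 h2 => rpow_pos_of_pos (hpos i h1 h2) δ
  have hey : ∀ i, 1 ≤ i → i ≤ N - 1 → Ei i ^ β = e i ^ x := by
    intro i h1 h2
    rw [he, ← rpow_mul (hpos i h1 h2).le, hx, mul_div_cancel₀ _ hδ.ne']
  have hapos : ∀ h, 1 ≤ h → h ≤ N - 1 → 0 < ∑ i ∈ Icc 1 h, e i := by
    intro h h1 h2
    exact sum_pos (fun i hi => hepos i (mem_Icc.1 hi).1 ((mem_Icc.1 hi).2.trans h2))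
      ⟨1, mem_Icc.2 ⟨le_rfl, h1⟩⟩
  have hs0 : 0 < s := by
    refine lt_of_lt_of_le ?_ (hqs 1 le_rfl (by omega))
    have h₁ := hapos 1 le_rfl (by omega)
    have h₂ := hepos 2 (by omega) (by omega)
    simp only [he] at h₁ h₂
    norm_num
    norm_num at h₁
    positivity
  have hlow : ∀ r, s ≤ r → ∀ h, 1 ≤ h → h < N - 1 →
      ((h : ℝ) / r) ^ x * Ei (h + 1) ^ β ≤
        recursiveSum (fun h => (1 + r / (h : ℝ)) ^ (x - 1))
          (fun k => (1 + ((k : ℝ) - 1) / r) ^ (x - 1)) (fun k => Ei k ^ β) h := by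
    intro r hr h h1 h2
    have hr0 : 0 < r := by linarith
    have hq := (hqs h h1 (by omega)).trans hr
    rw [div_le_iff₀ (hapos h h1 (by omega))] at hq
    have heq : recursiveSum (fun h => (1 + r / (h : ℝ)) ^ (x - 1))
          (fun k => (1 + ((k : ℝ) - 1) / r) ^ (x - 1)) (fun k => Ei k ^ β) h =
        recursiveSum (fun h => (1 + r / (h : ℝ)) ^ (x - 1))
          (fun k => (1 + ((k : ℝ) - 1) / r) ^ (x - 1)) (fun k => e k ^ x) h := by
      refine sum_congr rfl fun k hk => ?_
      have hk' := mem_Icc.1 hk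
      simp only [hey k hk'.1 (by omega)]
    have hb := hepos (h + 1) (by omega) (by omega)
    rw [heq, hey (h + 1) (by omega) (by omega), ← mul_rpow (by positivity) hb.le]
    refine le_trans (rpow_le_rpow (by positivity) ?_ (by linarith))
      (rpow_sum_le_recursiveSum hx1 hr0 e h1 fun i hi1 hi2 => (hepos i hi1 (by omega)).le)
    rw [div_mul_eq_mul_div, div_le_iff₀ hr0]
    simp only [he] at hq ⊢
    linarith
  have hy : ∀ h, 1 ≤ h → h < N - 1 → 0 ≤ Ei (h + 1) ^ β := fun h h1 h2 =>
    (rpow_pos_of_pos (hpos (h + 1) (by omega) (by omega)) β).le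
  have hcast : ∀ h : ℕ, ((h + 1 : ℕ) : ℝ) - 1 = h := fun h => by push_cast; ring
  have hcoeff : ∀ h : ℕ, 0 ≤ (((h : ℝ) + 1) ^ x - 1) / (h : ℝ) ^ x := fun h =>
    div_nonneg (sub_nonneg.2 (one_le_rpow (by linarith [h.cast_nonneg (α := ℝ)]) (by linarith)))
      (by positivity)
  have hprod_nonneg : ∀ h, 1 ≤ h → h < N - 1 →
      0 ≤ recursiveSum (fun h => (((h : ℝ) + 1) ^ x - 1) / (h : ℝ) ^ x) (fun _ => 1)
        (fun k => Ei k ^ β) h := fun h h1 h2 =>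
    sum_nonneg fun k hk => mul_nonneg
      (mul_nonneg zero_le_one (prod_nonneg fun i _ => hcoeff i))
      (rpow_pos_of_pos (hpos k (mem_Icc.1 hk).1 (by have := (mem_Icc.1 hk).2; omega)) β).le
  have step₁ := recursiveSum_le_recursiveSum (n := N - 1)
    (c := fun h => (1 + s / (h : ℝ)) ^ (x - 1)) (d := fun k => (1 + ((k : ℝ) - 1) / s) ^ (x - 1))
    (c' := fun h => (1 + 1 / (h : ℝ)) ^ (x - 1))
    (d' := fun k => (1 + ((k : ℝ) - 1) / 1) ^ (x - 1))
    (y := fun k => Ei k ^ β) (by omega) (by simp) (fun h _ _ => by positivity)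
    (fun h h1 h2 => by
      simp only [hcast]
      exact weighted_step_le_one hx1 (by exact_mod_cast h1) hs0 hs1 (hy h h1 h2)
        (hlow s le_rfl h h1 h2))
  have step₂ := recursiveSum_le_recursiveSum (n := N - 1)
    (c := fun h => (1 + 1 / (h : ℝ)) ^ (x - 1))
    (d := fun k => (1 + ((k : ℝ) - 1) / 1) ^ (x - 1))
    (c' := fun h => (((h : ℝ) + 1) ^ x - 1) / (h : ℝ) ^ x) (d' := fun _ => 1)
    (y := fun k => Ei k ^ β) (by omega) (by simp) (fun h _ _ => hcoeff h)
    (fun h h1 h2 => by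
      have hB := hlow 1 hs1 h h1 h2
      rw [div_one] at hB
      simp only [hcast, one_mul]
      exact weighted_step_le_prod hx1 (by exact_mod_cast h1) hB)
  have step₃ := recursiveSum_le_recursiveSum (n := N - 1)
    (c := fun h => (((h : ℝ) + 1) ^ x - 1) / (h : ℝ) ^ x) (d := fun _ => 1)
    (c' := fun _ => (2 : ℝ) ^ x - 1) (d' := fun _ => 1)
    (y := fun k => Ei k ^ β) (by omega) rfl
    (fun h _ _ => sub_nonneg.2 (one_le_rpow (by norm_num) (by linarith)))
    (fun h h1 h2 => by
      have := mul_le_mul_of_nonneg_right (prod_coeff_le hx1 (h := h) (by exact_mod_cast h1))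
        (hprod_nonneg h h1 h2)
      simpa using this)
  have eq₁ := recursiveSum_pred_eq (fun h => (1 + s / h) ^ (x - 1))
    (fun k => (1 + (k - 1) / s) ^ (x - 1)) (fun k => Ei k ^ β) (N := N) (by omega)
  have eq₂ := recursiveSum_pred_eq (fun h => (1 + 1 / h) ^ (x - 1))
    (fun k => (1 + (k - 1) / 1) ^ (x - 1)) (fun k => Ei k ^ β) (N := N) (by omega)
  have eq₃ := recursiveSum_pred_eq (fun h => ((h + 1) ^ x - 1) / h ^ x)
    (fun _ => 1) (fun k => Ei k ^ β) (N := N) (by omega)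
  have eq₄ : recursiveSum (fun _ => (2 : ℝ) ^ x - 1) (fun _ => 1) (fun k => Ei k ^ β) (N - 1) =
      ∑ k ∈ Icc 1 (N - 1), ((2 : ℝ) ^ x - 1) ^ (N - 1 - k) * Ei k ^ β := by
    simp [recursiveSum]
  have hsub : ∀ t : ℝ, 1 + (t - 1) / 1 = t := fun t => by ring
  rw [show (N : ℝ) - 1 - 1 = N - 2 by ring] at eq₁
  simp only [hsub] at eq₂ step₁ step₂
  simp only [one_mul] at eq₃
  rw [← eq₁, ← eq₂, ← eq₃, ← eq₄]
  exact ⟨step₁, step₂, step₃⟩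
end

section
/- Let t, m, x be real numbers with t ≥ m ≥ 1 and 0 ≤ x ≤ 1. Then (1+t)^x ≤ t^x + (1+m)^x − m^x + (x·m²/(1+m)²)·(t^(x−1) − m^(x−1)). -/
open Real

/-- A rescaled form of Bernoulli's inequality for exponents `1 - x ∈ [0, 1]`. -/
lemma one_add_rpow_sub_one_le {t x : ℝ} (ht : 0 < t) (hx0 : 0 ≤ x) (hx1 : x ≤ 1) :
    (1 + t) ^ (x - 1) ≤ t ^ (x - 1) * (1 - (1 - x) / (1 + t)) := by
  have ht' : 0 < 1 + t := by linarith
  have bernoulli : (1 + -1 / (1 + t)) ^ (1 - x) ≤ 1 + (1 - x) * (-1 / (1 + t)) := by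
    refine rpow_one_add_le_one_add_mul_self ?_ (by linarith) (by linarith)
    rw [le_div_iff₀ ht']
    linarith
  have hbase : 1 + -1 / (1 + t) = t / (1 + t) := by
    field_simp
    ring
  have hratio : (t / (1 + t)) ^ (1 - x) * t ^ (x - 1) = (1 + t) ^ (x - 1) := by
    rw [div_rpow ht.le ht'.le, ← neg_sub x 1, rpow_neg ht.le, rpow_neg ht'.le]
    have := (rpow_pos_of_pos ht (x - 1)).ne'
    have := (rpow_pos_of_pos ht' (x - 1)).ne'
    field_simp
  rw [hbase] at bernoulli
  calc (1 + t) ^ (x - 1) = (t / (1 + t)) ^ (1 - x) * t ^ (x - 1) := hratio.symm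
    _ ≤ (1 + (1 - x) * (-1 / (1 + t))) * t ^ (x - 1) := by gcongr
    _ = t ^ (x - 1) * (1 - (1 - x) / (1 + t)) := by ring

/-- The correction coefficient is small enough for the derivative in `t` to be nonnegative. -/
lemma sq_div_one_add_sq_div_le {t m : ℝ} (hm : 0 < m) (htm : m ≤ t) :
    m ^ 2 / (1 + m) ^ 2 / t ≤ 1 / (1 + t) := by
  have ht : 0 < t := hm.trans_le htm
  rw [div_div, div_le_div_iff₀ (by positivity) (by positivity)]
  nlinarith [mul_nonneg hm.le (sub_nonneg.2 htm), mul_pos hm ht]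

/-- Lemma 4.1: binomial estimate with a second-order correction term,
for `t ≥ m ≥ 1` and `0 ≤ x ≤ 1`. -/
theorem binomial_correction_bound (t m x : ℝ) (hm : 1 ≤ m) (htm : m ≤ t)
    (hx0 : 0 ≤ x) (hx1 : x ≤ 1) :
    (1 + t) ^ x ≤
      t ^ x + (1 + m) ^ x - m ^ x +
        x * m ^ 2 / (1 + m) ^ 2 * (t ^ (x - 1) - m ^ (x - 1)) := by
  have hm0 : 0 < m := by linarith
  set c : ℝ := x * m ^ 2 / (1 + m) ^ 2 with hc
  have hderiv : ∀ s : ℝ, m ≤ s →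
      HasDerivAt (fun s : ℝ ↦ s ^ x + c * s ^ (x - 1) - (1 + s) ^ x)
        (x * s ^ (x - 1) + c * ((x - 1) * s ^ (x - 1 - 1)) - x * (1 + s) ^ (x - 1)) s := by
    intro s hs
    have hs0 : 0 < s := hm0.trans_le hs
    have hshift : HasDerivAt (fun s : ℝ ↦ (1 + s) ^ x) (x * (1 + s) ^ (x - 1)) s := by
      simpa using ((hasDerivAt_id s).const_add 1).rpow_const (p := x)
        (Or.inl (by simp only [id]; positivity))
    exact ((hasDerivAt_rpow_const (Or.inl hs0.ne')).add
      ((hasDerivAt_rpow_const (Or.inl hs0.ne')).const_mul c)).sub hshift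
  have hmono : MonotoneOn (fun s : ℝ ↦ s ^ x + c * s ^ (x - 1) - (1 + s) ^ x) (Set.Ici m) := by
    refine monotoneOn_of_hasDerivWithinAt_nonneg (convex_Ici m)
      (fun s hs ↦ (hderiv s hs).continuousAt.continuousWithinAt)
      (fun s hs ↦ (hderiv s (interior_subset hs)).hasDerivWithinAt) fun s hs ↦ ?_
    have hs' : m ≤ s := interior_subset hs
    have hs0 : 0 < s := hm0.trans_le hs'
    have hpow : 0 < s ^ (x - 1) := rpow_pos_of_pos hs0 _
    have hcoeff : (1 - x) * (m ^ 2 / (1 + m) ^ 2 / s) ≤ (1 - x) * (1 / (1 + s)) :=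
      mul_le_mul_of_nonneg_left (sq_div_one_add_sq_div_le hm0 hs') (by linarith)
    have hbound : (1 + s) ^ (x - 1) ≤
        s ^ (x - 1) * (1 - (1 - x) * (m ^ 2 / (1 + m) ^ 2 / s)) := by
      refine (one_add_rpow_sub_one_le hs0 hx0 hx1).trans ?_
      refine mul_le_mul_of_nonneg_left ?_ hpow.le
      rw [div_eq_mul_one_div (1 - x)]
      linarith
    have hmul := mul_le_mul_of_nonneg_left hbound hx0
    have hfactor : x * s ^ (x - 1) + c * ((x - 1) * (s ^ (x - 1) / s)) =
        x * (s ^ (x - 1) * (1 - (1 - x) * (m ^ 2 / (1 + m) ^ 2 / s))) := by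
      rw [hc]
      ring
    rw [rpow_sub_one hs0.ne' (x - 1), hfactor]
    linarith
  have hle := hmono Set.self_mem_Ici (Set.mem_Ici.2 htm) htm
  simp only at hle
  linarith
end

section
/- Let t, m, x be real numbers with t ≥ m ≥ 1 and 0 ≤ x ≤ 1. Then the following chain of inequalities holds: (1+t)^x ≤ t^x + (1+m)^x − m^x + (x·m²/(1+m)²)·(t^(x−1) − m^(x−1)) ≤ t^x + (1+m)^x − m^x ≤ t^x + 2^x − 1 ≤ t^x + x ≤ t^x + 1. -/
open Real

/-- Bernoulli's inequality for `s / (1 + s) = 1 - 1 / (1 + s)`, rewritten as a comparison of the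
derivatives of `(1 + s) ^ x` and `s ^ x`. -/
theorem rpow_sub_one_one_add_le {s x : ℝ} (hs : 0 < s) (hx0 : 0 ≤ x) (hx1 : x ≤ 1) :
    (1 + s) ^ (x - 1) ≤ s ^ (x - 1) * (1 - (1 - x) / (1 + s)) := by
  have h1 : 0 < 1 + s := by linarith
  have bernoulli : (s / (1 + s)) ^ (1 - x) ≤ 1 - (1 - x) / (1 + s) := by
    have hbase : 1 + -(1 / (1 + s)) = s / (1 + s) := by field_simp; ring
    have h := rpow_one_add_le_one_add_mul_self (s := -(1 / (1 + s)))
      (by rw [neg_le_neg_iff, div_le_one h1]; linarith) (sub_nonneg.2 hx1)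
      (sub_le_self 1 hx0)
    rw [hbase] at h
    exact h.trans_eq (by ring)
  calc (1 + s) ^ (x - 1) = s ^ (x - 1) * (s / (1 + s)) ^ (1 - x) := by
        rw [div_rpow hs.le h1.le, ← neg_sub 1 x, rpow_neg h1.le, rpow_neg hs.le]
        have := (rpow_pos_of_pos hs (1 - x)).ne'
        field_simp
    _ ≤ _ := by gcongr

/-- The increment `(1 + s) ^ x - s ^ x` remains decreasing on `[a, ∞)` after subtracting the
correction term `x * c * s ^ (x - 1)`, provided `c ≤ a / (1 + a)`. -/
theorem antitoneOn_one_add_rpow_sub {a c x : ℝ} (ha : 0 < a) (hc : c ≤ a / (1 + a))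
    (hx0 : 0 ≤ x) (hx1 : x ≤ 1) :
    AntitoneOn (fun s : ℝ ↦ (1 + s) ^ x - s ^ x - x * c * s ^ (x - 1)) (Set.Ici a) := by
  have hderiv : ∀ s ∈ Set.Ici a,
      HasDerivAt (fun s : ℝ ↦ (1 + s) ^ x - s ^ x - x * c * s ^ (x - 1))
        (x * (1 + s) ^ (x - 1) - x * s ^ (x - 1) -
          x * c * ((x - 1) * s ^ (x - 1 - 1))) s := by
    intro s hs
    have hs0 : 0 < s := ha.trans_le hs
    have h1 : HasDerivAt (fun s : ℝ ↦ (1 + s) ^ x) (x * (1 + s) ^ (x - 1)) s := by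
      simpa using ((hasDerivAt_id s).const_add 1).rpow_const (p := x)
        (Or.inl (by simp only [id]; positivity))
    exact (h1.sub (hasDerivAt_rpow_const (Or.inl hs0.ne'))).sub
      ((hasDerivAt_rpow_const (Or.inl hs0.ne')).const_mul (x * c))
  refine antitoneOn_of_deriv_nonpos (convex_Ici a)
    (fun s hs ↦ (hderiv s hs).continuousAt.continuousWithinAt)
    (fun s hs ↦ (hderiv s (interior_subset hs)).differentiableAt.differentiableWithinAt) ?_
  intro s hs
  have has : a ≤ s := interior_subset hs
  have hs0 : 0 < s := ha.trans_le has
  rw [(hderiv s has).deriv, rpow_sub_one hs0.ne' (x - 1)]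
  have hcs : c / s ≤ 1 / (1 + s) := by
    have : a / (1 + a) ≤ s / (1 + s) := by
      rw [div_le_div_iff₀ (by linarith) (by linarith)]; linarith
    rw [div_le_iff₀ hs0]
    exact (hc.trans this).trans_eq (by ring)
  have hpow := mul_le_mul_of_nonneg_left (rpow_sub_one_one_add_le hs0 hx0 hx1) hx0
  have hcorr := mul_le_mul_of_nonneg_left hcs
    (mul_nonneg (mul_nonneg hx0 (rpow_pos_of_pos hs0 (x - 1)).le) (sub_nonneg.2 hx1))
  linear_combination hpow + hcorr

/-- Eq. (4.2): the chain of upper bounds refining `(1+t)^x ≤ t^x + 1`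
for `t ≥ m ≥ 1` and `0 ≤ x ≤ 1`. -/
theorem binomial_correction_chain (t m x : ℝ) (hm : 1 ≤ m) (htm : m ≤ t)
    (hx0 : 0 ≤ x) (hx1 : x ≤ 1) :
    (1 + t) ^ x ≤
        t ^ x + (1 + m) ^ x - m ^ x +
          x * m ^ 2 / (1 + m) ^ 2 * (t ^ (x - 1) - m ^ (x - 1)) ∧
      t ^ x + (1 + m) ^ x - m ^ x +
          x * m ^ 2 / (1 + m) ^ 2 * (t ^ (x - 1) - m ^ (x - 1)) ≤
        t ^ x + (1 + m) ^ x - m ^ x ∧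
      t ^ x + (1 + m) ^ x - m ^ x ≤ t ^ x + (2 : ℝ) ^ x - 1 ∧
      t ^ x + (2 : ℝ) ^ x - 1 ≤ t ^ x + x ∧
      t ^ x + x ≤ t ^ x + 1 := by
  have hm0 : 0 < m := by linarith
  refine ⟨?_, ?_, ?_, ?_, ?_⟩
  · have hc : m ^ 2 / (1 + m) ^ 2 ≤ m / (1 + m) := by
      rw [← div_pow]
      exact pow_le_of_le_one (by positivity) ((div_le_one (by positivity)).2 (by linarith))
        two_ne_zero
    have h := antitoneOn_one_add_rpow_sub hm0 hc hx0 hx1 Set.self_mem_Ici htm htm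
    simp only at h
    linear_combination h
  · have h : t ^ (x - 1) ≤ m ^ (x - 1) :=
      rpow_le_rpow_of_nonpos hm0 htm (sub_nonpos.2 hx1)
    have := mul_nonpos_of_nonneg_of_nonpos
      (show 0 ≤ x * m ^ 2 / (1 + m) ^ 2 by positivity) (sub_nonpos.2 h)
    linarith
  · have h := antitoneOn_one_add_rpow_sub (c := 0) one_pos (by norm_num) hx0 hx1
      Set.self_mem_Ici hm hm
    norm_num at h
    linarith
  · have h := rpow_one_add_le_one_add_mul_self (s := 1) (by norm_num) hx0 hx1
    norm_num at h
    linarith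
  · linarith
end

section
/- Let N ≥ 2 be an integer, let p_1 ≥ p_2 ≥ ⋯ ≥ p_N > 0 be real numbers, and let 0 ≤ x ≤ 1. Then (∑_{i=1}^{N} p_i)^x ≤ p_1^x + ∑_{k=2}^{N} (k^x − (k−1)^x)·p_k^x + x·∑_{v=2}^{N} ((v−1)²/v²)·( ((p_1 + ⋯ + p_{v−1})/p_v)^(x−1) − (v−1)^(x−1) )·p_v^x. -/
open Real Finset

/-- Lower bound for the decrease of `t ↦ t ^ (x - 1)` over a unit step. -/
lemma correction_le_rpow_sub_rpow {m t x : ℝ} (hm : 0 < m) (hmt : m ≤ t)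
    (hx0 : 0 ≤ x) (hx1 : x ≤ 1) :
    (1 - x) * (m ^ 2 / (1 + m) ^ 2) * t ^ (x - 2) ≤ t ^ (x - 1) - (1 + t) ^ (x - 1) := by
  have ht : 0 < t := hm.trans_le hmt
  have bernoulli : (t / (1 + t)) ^ (1 - x) ≤ 1 - (1 - x) / (1 + t) := by
    have h := rpow_one_add_le_one_add_mul_self (s := -(1 / (1 + t)))
      (by rw [neg_le_neg_iff, div_le_one (by positivity)]; linarith)
      (show 0 ≤ 1 - x by linarith) (by linarith)
    have e : 1 + -(1 / (1 + t)) = t / (1 + t) := by field_simp; ring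
    rw [e] at h
    calc _ ≤ _ := h
      _ = _ := by ring
  have ratio : m ^ 2 / (1 + m) ^ 2 / t ≤ 1 / (1 + t) := by
    rw [div_div, div_le_div_iff₀ (by positivity) (by positivity)]
    nlinarith [mul_nonneg hm.le (sub_nonneg.2 hmt), mul_pos hm ht]
  have factor : (1 + t) ^ (x - 1) = t ^ (x - 1) * (t / (1 + t)) ^ (1 - x) := by
    rw [div_rpow ht.le (by positivity), show x - 1 = -(1 - x) by ring,
      rpow_neg ht.le, rpow_neg (by positivity)]
    have := (rpow_pos_of_pos ht (1 - x)).ne'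
    field_simp
  have shift : t ^ (x - 2) = t ^ (x - 1) / t := by
    rw [show x - 2 = x - 1 - 1 by ring, rpow_sub_one ht.ne']
  have h : (1 - x) * (m ^ 2 / (1 + m) ^ 2 / t) ≤ 1 - (t / (1 + t)) ^ (1 - x) := by
    have := mul_le_mul_of_nonneg_left ratio (show 0 ≤ 1 - x by linarith)
    rw [mul_one_div] at this
    linarith
  calc _ = t ^ (x - 1) * ((1 - x) * (m ^ 2 / (1 + m) ^ 2 / t)) := by rw [shift]; ring
    _ ≤ t ^ (x - 1) * (1 - (t / (1 + t)) ^ (1 - x)) :=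
      mul_le_mul_of_nonneg_left h (by positivity)
    _ = _ := by rw [factor]; ring

lemma one_add_rpow_le_add_correction {m t x : ℝ} (hm : 0 < m) (hmt : m ≤ t)
    (hx0 : 0 ≤ x) (hx1 : x ≤ 1) :
    (1 + t) ^ x ≤ t ^ x + ((1 + m) ^ x - m ^ x) +
      x * (m ^ 2 / (1 + m) ^ 2) * (t ^ (x - 1) - m ^ (x - 1)) := by
  set c := m ^ 2 / (1 + m) ^ 2 with hc
  let F : ℝ → ℝ := fun s => s ^ x + x * c * s ^ (x - 1) - (1 + s) ^ x
  have hF : ∀ s, m ≤ s → HasDerivAt F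
      (x * s ^ (x - 1) + x * c * ((x - 1) * s ^ (x - 2)) - x * (1 + s) ^ (x - 1)) s := by
    intro s hs
    have hs0 : 0 < s := hm.trans_le hs
    have h1 := hasDerivAt_rpow_const (x := s) (p := x) (Or.inl hs0.ne')
    have h2 := hasDerivAt_rpow_const (x := s) (p := x - 1) (Or.inl hs0.ne')
    have h3 := ((hasDerivAt_id s).const_add 1).rpow_const (p := x)
      (Or.inl (by simp only [id]; positivity))
    refine ((h1.add (h2.const_mul (x * c))).sub h3).congr_deriv ?_
    simp only [id, show x - 1 - 1 = x - 2 by ring]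
    ring
  have mono : MonotoneOn F (Set.Ici m) := by
    refine monotoneOn_of_deriv_nonneg (convex_Ici m)
      (fun s hs => (hF s hs).continuousAt.continuousWithinAt)
      (fun s hs => (hF s (interior_subset hs)).differentiableAt.differentiableWithinAt) ?_
    intro s hs
    have hs' : m ≤ s := interior_subset hs
    rw [(hF s hs').deriv]
    have h := mul_le_mul_of_nonneg_left (correction_le_rpow_sub_rpow hm hs' hx0 hx1) hx0
    rw [← hc] at h
    linarith
  have h := mono Set.self_mem_Ici hmt hmt
  simp only [F] at h
  linarith

/-- Lemma 4.2: correction-term upper bound for the `x`-th power (`0 ≤ x ≤ 1`) of a sum of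
decreasing positive reals. -/
theorem sum_rpow_correction_upper_bound (N : ℕ) (hN : 2 ≤ N) (p : ℕ → ℝ) (x : ℝ)
    (hpos : ∀ i, 1 ≤ i → i ≤ N → 0 < p i)
    (hdec : ∀ i, 1 ≤ i → i < N → p (i + 1) ≤ p i)
    (hx0 : 0 ≤ x) (hx1 : x ≤ 1) :
    (∑ i ∈ Icc 1 N, p i) ^ x ≤
      p 1 ^ x + (∑ k ∈ Icc 2 N, ((k : ℝ) ^ x - ((k : ℝ) - 1) ^ x) * p k ^ x) +
        x * ∑ v ∈ Icc 2 N, ((v : ℝ) - 1) ^ 2 / (v : ℝ) ^ 2 *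
          (((∑ i ∈ Icc 1 (v - 1), p i) / p v) ^ (x - 1) - ((v : ℝ) - 1) ^ (x - 1)) *
            p v ^ x := by
  have hN1 : 1 ≤ N := by omega
  clear hN
  induction N, hN1 using Nat.le_induction with
  | base => simp
  | succ n hn ih =>
    have ih := ih (fun i h1 h2 => hpos i h1 (by omega)) (fun i h1 h2 => hdec i h1 (by omega))
    have hp : 0 < p (n + 1) := hpos _ (by omega) le_rfl
    have last_le : ∀ i ∈ Icc 1 n, p (n + 1) ≤ p i := by
      intro i hi
      rw [mem_Icc] at hi
      exact Nat.decreasingInduction' (P := fun j => p (n + 1) ≤ p j)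
        (fun k hk hik h => h.trans (hdec k (by omega) hk)) (by omega) le_rfl
    set S := ∑ i ∈ Icc 1 n, p i with hS
    have hn0 : (0 : ℝ) < n := by exact_mod_cast hn
    have hratio : (n : ℝ) ≤ S / p (n + 1) := by
      rw [le_div_iff₀ hp]
      simpa using card_nsmul_le_sum _ _ _ last_le
    have ht : 0 < S / p (n + 1) := hn0.trans_le hratio
    have hsum : S + p (n + 1) = (1 + S / p (n + 1)) * p (n + 1) := by field_simp; ring
    have hSx : S ^ x = (S / p (n + 1)) ^ x * p (n + 1) ^ x := by
      rw [← mul_rpow ht.le hp.le, div_mul_cancel₀ _ hp.ne']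
    have key := mul_le_mul_of_nonneg_right
      (one_add_rpow_le_add_correction hn0 hratio hx0 hx1) (rpow_nonneg hp.le x)
    rw [← mul_rpow (by positivity) hp.le, ← hsum] at key
    rw [sum_Icc_succ_top (by omega), sum_Icc_succ_top (by omega), sum_Icc_succ_top (by omega),
      ← hS, Nat.add_sub_cancel, ← hS]
    push_cast
    rw [add_sub_cancel_right, add_comm (n : ℝ) 1]
    rw [hSx] at ih
    linarith
end
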